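/- Let r ≥ 2 be even and p ≥ 1 with p | r/2. Then f_{r,p,0}(u,v,w) = 1, f_{r,p,1}(u,v,w) = u(1 + w^{r/2}), and for all n ≥ 2, f_{r,p,n}(u,v,w) = u(1 + w^{r/2})·f_{r,p,n−1}(u,v,w) + (n−1)(v + (r−1)w^r)·f_{r,p,n−2}(u,v,w). -/

import Mathlib

open Finset MvPolynomial

/-- The colored permutation group `G_{r,n}`: pairs `(z, τ)` with `z : (ℤ/rℤ)ⁿ`
and `τ` a permutation of `[n]`. -/
abbrev ColoredPerm (r n : ℕ) : Type := (Fin n → ZMod r) × Equiv.Perm (Fin n)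

/-- Multiplication in `G_{r,n}`:
`(z, τ)(z', τ') = ((zᵢ + z'_{τ⁻¹(i)})ᵢ, τ ∘ τ')`. -/
def cpMul {r n : ℕ} (x y : ColoredPerm r n) : ColoredPerm r n :=
  (fun i => x.1 i + y.1 (x.2⁻¹ i), x.2 * y.2)

/-- The identity element of `G_{r,n}`. -/
def cpOne (r n : ℕ) : ColoredPerm r n := (fun _ => 0, 1)

/-- `π` is an involution: `π² = 1`. -/
def IsCPInvolution {r n : ℕ} (π : ColoredPerm r n) : Prop := cpMul π π = cpOne r n

instance {r n : ℕ} (π : ColoredPerm r n) : Decidable (IsCPInvolution π) :=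
  decidable_of_iff (cpMul π π = cpOne r n) Iff.rfl

/-- `csum π = Σᵢ zᵢ(π)`, each color regarded as an integer in `{0, …, r−1}`. -/
def csum {r n : ℕ} (π : ColoredPerm r n) : ℕ := ∑ i, (π.1 i).val

/-- `fix π`: the number of absolute fixed points, `#{i ∈ [n] : τ(i) = i}`. -/
noncomputable def fixc {r n : ℕ} (π : ColoredPerm r n) : ℕ := Nat.card {i : Fin n // π.2 i = i}

/-- `exc_A π = #{i ∈ {1, …, n−1} : z_{τ(i)}(π) = 0 and τ(i) > i}`
(`Fin n` encodes `[n]` via `i ↦ i + 1`, so `i ∈ {1, …, n−1}` reads `(i : ℕ) + 1 < n`). -/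
noncomputable def excA {r n : ℕ} (π : ColoredPerm r n) : ℕ :=
  Nat.card {i : Fin n // (i : ℕ) + 1 < n ∧ π.1 (π.2 i) = 0 ∧ i < π.2 i}

/-- The colored excedance number `exc^Clr π = r·exc_A π + csum π`. -/
noncomputable def excClr {r n : ℕ} (π : ColoredPerm r n) : ℕ := r * excA π + csum π

/-- `f_{r,p,n}(u,v,w) = Σ_{π ∈ I_{r,p,n}} u^{fix π} v^{exc_A π} w^{csum π}` in
`ℤ[u,v,w]`, where `I_{r,p,n}` is the set of involutions `π` of `G_{r,n}` with
`csum π ≡ 0 (mod p)`; the variables `u, v, w` are `X 0, X 1, X 2`. -/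
noncomputable def fpoly (r p n : ℕ) [NeZero r] : MvPolynomial (Fin 3) ℤ :=
  ∑ π : ColoredPerm r n,
    if IsCPInvolution π ∧ p ∣ csum π then
      X 0 ^ fixc π * X 1 ^ excA π * X 2 ^ csum π
    else 0

/-- The number of permutations of `n` letters that are products of `k` disjoint transpositions. -/
def numTranspositionProducts (n k : ℕ) : ℕ := n.choose (2 * k) * ∏ j ∈ range k, (2 * j + 1)

theorem numTranspositionProducts_zero_right (n : ℕ) : numTranspositionProducts n 0 = 1 := by
  simp [numTranspositionProducts]

theorem numTranspositionProducts_of_lt {n k : ℕ} (h : n < 2 * k) :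
    numTranspositionProducts n k = 0 := by
  simp [numTranspositionProducts, Nat.choose_eq_zero_of_lt h]

theorem numTranspositionProducts_succ_succ (n k : ℕ) :
    numTranspositionProducts (n + 2) (k + 1) =
      numTranspositionProducts (n + 1) (k + 1) + (n + 1) * numTranspositionProducts n k := by
  have h := Nat.add_one_mul_choose_eq n (2 * k)
  have h' := Nat.choose_succ_succ (n + 1) (2 * k + 1)
  simp only [numTranspositionProducts, prod_range_succ]
  rw [show 2 * (k + 1) = 2 * k + 1 + 1 by ring, h']
  linear_combination (∏ j ∈ range k, (2 * j + 1)) * h.symm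

theorem factorial_two_mul_eq (k : ℕ) :
    (2 * k).factorial = 2 ^ k * k.factorial * ∏ j ∈ range k, (2 * j + 1) := by
  induction k with
  | zero => simp
  | succ k ih =>
    rw [show 2 * (k + 1) = 2 * k + 1 + 1 by ring, Nat.factorial_succ, Nat.factorial_succ, ih,
      prod_range_succ, Nat.factorial_succ]
    ring

/-- The number of excedances of a permutation. -/
def numExc {n : ℕ} (τ : Equiv.Perm (Fin n)) : ℕ := #{i | i < τ i}

theorem card_support_eq_two_mul_numExc {n : ℕ} {τ : Equiv.Perm (Fin n)}
    (hτ : ∀ i, τ (τ i) = i) : #τ.support = 2 * numExc τ := by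
  have hflip : #{i | τ i < i} = numExc τ :=
    card_bij (fun i _ => τ i) (by simp [hτ]) (by simp)
      (fun i hi => ⟨τ i, by simpa [hτ] using hi, hτ i⟩)
  have hunion : τ.support = univ.filter (fun i => i < τ i) ∪ univ.filter (fun i => τ i < i) := by
    ext i
    simp only [Equiv.Perm.mem_support, mem_union, mem_filter, mem_univ, true_and]
    rw [ne_iff_lt_or_gt, or_comm]
  rw [hunion, card_union_of_disjoint, hflip, numExc, two_mul]
  exact disjoint_filter.2 fun i _ h h' => lt_asymm h h'

theorem card_fixed_eq_sub_two_mul_numExc {n : ℕ} {τ : Equiv.Perm (Fin n)}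
    (hτ : ∀ i, τ (τ i) = i) : #{i | τ i = i} = n - 2 * numExc τ := by
  have h := card_filter_add_card_filter_not (s := (univ : Finset (Fin n))) (fun i => τ i = i)
  have h' := card_support_eq_two_mul_numExc hτ
  rw [Equiv.Perm.support] at h'
  simp only [card_univ, Fintype.card_fin] at h
  change #{i | ¬ τ i = i} = _ at h'
  omega

theorem numExc_le {n : ℕ} (τ : Equiv.Perm (Fin n)) : numExc τ ≤ n :=
  (card_le_univ _).trans_eq (Fintype.card_fin n)

theorem involutive_and_numExc_eq_iff {n k : ℕ} {τ : Equiv.Perm (Fin n)} :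
    ((∀ i, τ (τ i) = i) ∧ numExc τ = k) ↔ τ.cycleType = Multiset.replicate k 2 := by
  have hsq : (∀ i, τ (τ i) = i) ↔ ∀ c ∈ τ.cycleType, c = 2 := by
    rw [← Equiv.Perm.pow_prime_eq_one_iff, sq, Equiv.ext_iff]
    rfl
  rw [Multiset.eq_replicate, ← hsq, and_comm]
  refine and_congr_left fun h => ?_
  have hrep := Multiset.eq_replicate_card.2 (hsq.1 h)
  have hsum := Equiv.Perm.sum_cycleType τ
  rw [card_support_eq_two_mul_numExc h, hrep, Multiset.sum_replicate, smul_eq_mul] at hsum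
  omega

theorem card_filter_involutive_numExc (n k : ℕ) :
    #{τ : Equiv.Perm (Fin n) | (∀ i, τ (τ i) = i) ∧ numExc τ = k} =
      numTranspositionProducts n k := by
  simp only [involutive_and_numExc_eq_iff]
  have h := Equiv.Perm.card_of_cycleType_mul_eq (Fin n) (Multiset.replicate k 2)
  have hcount : (∏ c ∈ (Multiset.replicate k 2).toFinset,
      (Multiset.count c (Multiset.replicate k 2)).factorial) = k.factorial := by
    rcases eq_or_ne k 0 with rfl | hk
    · simp
    · simp [Multiset.toFinset_replicate, hk]
  rw [hcount] at h
  simp only [Multiset.sum_replicate, Multiset.prod_replicate, Fintype.card_fin, smul_eq_mul] at h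
  by_cases hk : 2 * k ≤ n
  · rw [if_pos ⟨by omega, fun a ha => (Multiset.eq_of_mem_replicate ha).ge⟩] at h
    have hc := Nat.choose_mul_factorial_mul_factorial hk
    rw [factorial_two_mul_eq] at hc
    refine Nat.eq_of_mul_eq_mul_right (m := (n - k * 2).factorial * 2 ^ k * k.factorial)
      (by positivity) ?_
    rw [h, ← hc, numTranspositionProducts, mul_comm 2 k]
    ring
  · rw [if_neg (by omega)] at h
    rw [numTranspositionProducts_of_lt (by omega)]
    exact (mul_eq_zero.1 h).resolve_right (by positivity)

/-- The generating function of the involutions of `n` letters with weight `a` for each fixed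
point and weight `b` for each transposition, by number of transpositions. -/
theorem sum_involutive_eq_sum_range {R : Type*} [CommSemiring R] (n : ℕ) (a b : R) :
    (∑ τ : Equiv.Perm (Fin n) with ∀ i, τ (τ i) = i,
        a ^ #{i | τ i = i} * b ^ numExc τ) =
      ∑ k ∈ range (n + 1), numTranspositionProducts n k * (a ^ (n - 2 * k) * b ^ k) := by
  rw [← sum_fiberwise_of_maps_to (t := range (n + 1)) (g := numExc)
    (fun τ _ => mem_range_succ_iff.2 (numExc_le τ))]
  refine sum_congr rfl fun k _ => ?_
  rw [← card_filter_involutive_numExc, filter_filter, ← nsmul_eq_mul]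
  refine sum_eq_card_nsmul fun τ hτ => ?_
  obtain ⟨hinv, rfl⟩ := (mem_filter.1 hτ).2
  rw [card_fixed_eq_sub_two_mul_numExc hinv]

theorem sum_numTranspositionProducts_succ_succ {R : Type*} [CommSemiring R] (n : ℕ) (a b : R) :
    (∑ k ∈ range (n + 2 + 1), (numTranspositionProducts (n + 2) k : R) *
        (a ^ (n + 2 - 2 * k) * b ^ k)) =
      a * (∑ k ∈ range (n + 1 + 1), (numTranspositionProducts (n + 1) k : R) *
        (a ^ (n + 1 - 2 * k) * b ^ k)) +
      (n + 1) * b * ∑ k ∈ range (n + 1), (numTranspositionProducts n k : R) *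
        (a ^ (n - 2 * k) * b ^ k) := by
  have hfst : ∀ k, a * ((numTranspositionProducts (n + 1) (k + 1) : R) *
      (a ^ (n + 1 - 2 * (k + 1)) * b ^ (k + 1))) =
      numTranspositionProducts (n + 1) (k + 1) * (a ^ (n + 2 - 2 * (k + 1)) * b ^ (k + 1)) := by
    intro k
    by_cases hk : n + 1 < 2 * (k + 1)
    · simp [numTranspositionProducts_of_lt hk]
    · rw [show n + 2 - 2 * (k + 1) = n + 1 - 2 * (k + 1) + 1 by omega, pow_succ]
      ring
  have hlast : (∑ k ∈ range (n + 1), (numTranspositionProducts n k : R) *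
      (a ^ (n - 2 * k) * b ^ k)) = ∑ k ∈ range (n + 2), (numTranspositionProducts n k : R) *
      (a ^ (n - 2 * k) * b ^ k) := by
    rw [sum_range_succ _ (n + 1), numTranspositionProducts_of_lt (by omega : n < 2 * (n + 1))]
    simp
  have hmid : (∑ k ∈ range (n + 1 + 1), (numTranspositionProducts (n + 1) k : R) *
      (a ^ (n + 1 - 2 * k) * b ^ k)) = ∑ k ∈ range (n + 2 + 1),
      (numTranspositionProducts (n + 1) k : R) * (a ^ (n + 1 - 2 * k) * b ^ k) := by
    rw [sum_range_succ _ (n + 2),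
      numTranspositionProducts_of_lt (by omega : n + 1 < 2 * (n + 2))]
    simp
  rw [hlast, hmid, sum_range_succ' _ (n + 2), sum_range_succ' _ (n + 2), mul_add, mul_sum,
    mul_sum, add_right_comm, ← sum_add_distrib]
  congr 1
  · refine sum_congr rfl fun k _ => ?_
    rw [hfst, numTranspositionProducts_succ_succ,
      show n + 2 - 2 * (k + 1) = n - 2 * k by omega]
    push_cast
    ring
  · simp only [numTranspositionProducts_zero_right, Nat.cast_one, one_mul, mul_zero, Nat.sub_zero,
      pow_zero, mul_one]
    ring

theorem isCPInvolution_iff {r n : ℕ} (z : Fin n → ZMod r) (τ : Equiv.Perm (Fin n)) :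
    IsCPInvolution (z, τ) ↔ (∀ i, τ (τ i) = i) ∧ ∀ i, z i + z (τ i) = 0 := by
  simp only [IsCPInvolution, cpMul, cpOne, Prod.mk.injEq, Equiv.ext_iff, funext_iff,
    Equiv.Perm.mul_apply, Equiv.Perm.one_apply]
  rw [and_comm]
  refine and_congr_right fun h => forall_congr' fun i => ?_
  rw [Equiv.Perm.inv_eq_iff_eq.2 (h i).symm]

theorem val_add_val_of_add_eq_zero {r : ℕ} [NeZero r] {a b : ZMod r} (h : a + b = 0) :
    a.val + b.val = if a = 0 then 0 else r := by
  rw [eq_neg_of_add_eq_zero_right h, ZMod.neg_val]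
  split_ifs with ha
  · simp [ha]
  · exact Nat.add_sub_of_le a.val_lt.le

/-- The contribution of position `i`, colored by `a`, to `csum`, where the total color of each
transposition is attributed to the smaller of its two letters. -/
def localCsum {r n : ℕ} (τ : Equiv.Perm (Fin n)) (i : Fin n) (a : ZMod r) : ℕ :=
  if τ i = i then a.val else if i < τ i then (if a = 0 then 0 else r) else 0

theorem csum_eq_sum_localCsum {r n : ℕ} [NeZero r] {z : Fin n → ZMod r}
    {τ : Equiv.Perm (Fin n)} (hτ : ∀ i, τ (τ i) = i) (hz : ∀ i, z i + z (τ i) = 0) :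
    csum (z, τ) = ∑ i, localCsum τ i (z i) := by
  have hflip : (∑ i, if τ i < i then (z i).val else 0) =
      ∑ i, if i < τ i then (z (τ i)).val else 0 := by
    rw [← Equiv.sum_comp τ]
    simp only [hτ]
  have hsplit : csum (z, τ) = (∑ i, if τ i < i then (z i).val else 0) +
      ∑ i, if τ i < i then 0 else (z i).val := by
    rw [← sum_add_distrib]
    exact sum_congr rfl fun i _ => by split_ifs <;> simp
  rw [hsplit, hflip, ← sum_add_distrib]
  refine sum_congr rfl fun i _ => ?_
  rw [localCsum, ← val_add_val_of_add_eq_zero (hz i)]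
  rcases lt_trichotomy (τ i) i with h | h | h
  · simp [h, h.ne, h.not_gt]
  · simp [h]
  · simp [h, h.ne', h.not_gt, add_comm]

theorem half_dvd_localCsum {r n : ℕ} [NeZero r] (heven : Even r) {z : Fin n → ZMod r}
    {τ : Equiv.Perm (Fin n)} (hz : ∀ i, z i + z (τ i) = 0) (i : Fin n) :
    r / 2 ∣ localCsum τ i (z i) := by
  have hr : r / 2 ∣ r := Nat.div_dvd_of_dvd heven.two_dvd
  unfold localCsum
  split_ifs with h
  · have h2 := val_add_val_of_add_eq_zero (hz i)
    rw [h] at h2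
    split_ifs at h2
    · rw [show (z i).val = 0 by omega]
      exact dvd_zero _
    · rw [show (z i).val = r / 2 by omega]
  all_goals simp [hr]

theorem half_dvd_csum {r n : ℕ} [NeZero r] (heven : Even r) {z : Fin n → ZMod r}
    {τ : Equiv.Perm (Fin n)} (hτ : ∀ i, τ (τ i) = i) (hz : ∀ i, z i + z (τ i) = 0) :
    r / 2 ∣ csum (z, τ) := by
  rw [csum_eq_sum_localCsum hτ hz]
  exact dvd_sum fun i _ => half_dvd_localCsum heven hz i

/-- The contribution of position `i`, colored by `a`, to the monomial of an involution with
underlying permutation `τ`. -/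
noncomputable def localWeight {r n : ℕ} (τ : Equiv.Perm (Fin n)) (i : Fin n) (a : ZMod r) :
    MvPolynomial (Fin 3) ℤ :=
  if τ i = i then X 0 * X 2 ^ a.val
  else if i < τ i then (if a = 0 then X 1 else X 2 ^ r) else 1

theorem monomial_eq_prod_localWeight {r n : ℕ} [NeZero r] {z : Fin n → ZMod r}
    {τ : Equiv.Perm (Fin n)} (hτ : ∀ i, τ (τ i) = i) (hz : ∀ i, z i + z (τ i) = 0) :
    (X 0 ^ fixc (z, τ) * X 1 ^ excA (z, τ) * X 2 ^ csum (z, τ) : MvPolynomial (Fin 3) ℤ) =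
      ∏ i, localWeight τ i (z i) := by
  have hfix : fixc (z, τ) = ∑ i, if τ i = i then 1 else 0 := by
    rw [← card_filter, fixc, Nat.card_eq_fintype_card, Fintype.card_subtype]
  have hexc : excA (z, τ) = ∑ i, if i < τ i ∧ z i = 0 then 1 else 0 := by
    rw [← card_filter, excA, Nat.card_eq_fintype_card, Fintype.card_subtype]
    congr 1
    refine filter_congr fun i _ => ?_
    have hzi : z (τ i) = 0 ↔ z i = 0 := by
      rw [eq_neg_of_add_eq_zero_right (hz i), neg_eq_zero]
    simp only [hzi]
    have := (τ i).isLt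
    rw [Fin.lt_def]
    constructor
    · rintro ⟨-, h, h'⟩
      exact ⟨h', h⟩
    · rintro ⟨h, h'⟩
      exact ⟨by omega, h', h⟩
  rw [hfix, hexc, csum_eq_sum_localCsum hτ hz, ← prod_pow_eq_pow_sum, ← prod_pow_eq_pow_sum,
    ← prod_pow_eq_pow_sum, ← prod_mul_distrib, ← prod_mul_distrib]
  refine prod_congr rfl fun i _ => ?_
  unfold localWeight localCsum
  rcases lt_trichotomy (τ i) i with h | h | h
  · simp [h.ne, h.not_gt]
  · simp [h]
  · by_cases h0 : z i = 0 <;> simp [h.ne', h, h0]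

/-- The colors that may be chosen freely at position `i` of an involution with underlying
permutation `τ`, the color of the larger letter of a transposition being normalized to `0`. -/
def localColors {n : ℕ} (r : ℕ) [NeZero r] (τ : Equiv.Perm (Fin n)) (i : Fin n) :
    Finset (ZMod r) :=
  if τ i = i then univ.filter (fun a => a + a = 0) else if i < τ i then univ else {0}

theorem filter_add_self_eq_zero {r : ℕ} [NeZero r] (heven : Even r) :
    ({a | a + a = 0} : Finset (ZMod r)) = {0, ((r / 2 : ℕ) : ZMod r)} := by
  have hpos := NeZero.pos r
  have h2 := Nat.two_mul_div_two_of_even heven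
  ext a
  simp only [mem_filter, mem_univ, true_and, mem_insert, mem_singleton]
  constructor
  · intro h
    have hval := val_add_val_of_add_eq_zero h
    split_ifs at hval with h0
    · exact Or.inl h0
    · right
      rw [← ZMod.natCast_zmod_val a]
      congr 1
      omega
  · rintro (rfl | rfl)
    · simp
    · rw [← Nat.cast_add, ← two_mul, h2, ZMod.natCast_self]

theorem sum_localColors_localWeight {r n : ℕ} [NeZero r] (heven : Even r)
    (τ : Equiv.Perm (Fin n)) (i : Fin n) :
    ∑ a ∈ localColors r τ i, localWeight τ i a =
      (if τ i = i then X 0 * (1 + X 2 ^ (r / 2)) else 1) *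
        if i < τ i then X 1 + ((r - 1 : ℕ) : MvPolynomial (Fin 3) ℤ) * X 2 ^ r else 1 := by
  have hpos := NeZero.pos r
  have h2 := Nat.two_mul_div_two_of_even heven
  unfold localColors localWeight
  rcases lt_trichotomy (τ i) i with h | h | h
  · simp [h.ne, h.not_gt]
  · have hval : ((r / 2 : ℕ) : ZMod r).val = r / 2 := ZMod.val_natCast_of_lt (by omega)
    have hne : (0 : ZMod r) ≠ ((r / 2 : ℕ) : ZMod r) := fun h0 => by
      have := congrArg ZMod.val h0
      rw [hval, ZMod.val_zero] at this
      omega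
    simp only [h, if_true, lt_irrefl, if_false, filter_add_self_eq_zero heven, sum_pair hne, hval,
      ZMod.val_zero]
    ring
  · simp only [h, h.ne', if_true, if_false]
    rw [sum_ite, filter_eq' univ, if_pos (mem_univ _), sum_singleton, sum_const, filter_ne',
      card_erase_of_mem (mem_univ _), card_univ, ZMod.card, nsmul_eq_mul, one_mul]

theorem sum_colorings_eq {r n : ℕ} [NeZero r] (heven : Even r)
    {τ : Equiv.Perm (Fin n)} (hτ : ∀ i, τ (τ i) = i) :
    ∑ z : Fin n → ZMod r with ∀ i, z i + z (τ i) = 0, ∏ i, localWeight τ i (z i) =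
      (X 0 * (1 + X 2 ^ (r / 2))) ^ #{i | τ i = i} *
        (X 1 + ((r - 1 : ℕ) : MvPolynomial (Fin 3) ℤ) * X 2 ^ r) ^ numExc τ := by
  rw [numExc, ← prod_const, ← prod_const, prod_filter, prod_filter, ← prod_mul_distrib]
  simp only [← sum_localColors_localWeight heven]
  rw [prod_univ_sum]
  refine sum_bij' (fun z _ i => if τ i < i then 0 else z i)
    (fun q _ i => if τ i < i then -q (τ i) else q i) ?_ ?_ ?_ ?_ ?_
  · intro z hz
    have hz := (mem_filter.1 hz).2
    refine Fintype.mem_piFinset.2 fun i => ?_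
    have hzi := hz i
    unfold localColors
    rcases lt_trichotomy (τ i) i with h | h | h
    · simp [h, h.ne, h.not_gt]
    · rw [h] at hzi
      simp [h, hzi]
    · simp [h, h.ne']
  · intro q hq
    refine mem_filter.2 ⟨mem_univ _, fun i => ?_⟩
    have hqi := Fintype.mem_piFinset.1 hq i
    unfold localColors at hqi
    simp only [hτ]
    rcases lt_trichotomy (τ i) i with h | h | h
    · simp [h, h.not_gt]
    · simp only [h, if_true, mem_filter, mem_univ, true_and] at hqi
      simp [h, hqi]
    · simp [h, h.not_gt]
  · intro z hz
    have hz := (mem_filter.1 hz).2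
    funext i
    simp only [hτ]
    split_ifs with h h'
    · exact absurd h' h.not_gt
    · exact (eq_neg_of_add_eq_zero_left (hz i)).symm
    · rfl
  · intro q hq
    have hq := Fintype.mem_piFinset.1 hq
    funext i
    have hqi := hq i
    unfold localColors at hqi
    split_ifs with h
    · simpa [h.ne, h.not_gt, eq_comm] using hqi
    · simp [h]
  · intro z _
    refine prod_congr rfl fun i _ => ?_
    unfold localWeight
    rcases lt_trichotomy (τ i) i with h | h | h
    · simp [h.ne, h.not_gt]
    · simp [h]
    · simp [h.ne', h.not_gt]

theorem fpoly_eq_sum_involutive {r p : ℕ} [NeZero r] (n : ℕ) (heven : Even r)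
    (hpr : p ∣ r / 2) :
    fpoly r p n = ∑ τ : Equiv.Perm (Fin n) with ∀ i, τ (τ i) = i,
      (X 0 * (1 + X 2 ^ (r / 2))) ^ #{i | τ i = i} *
        (X 1 + ((r - 1 : ℕ) : MvPolynomial (Fin 3) ℤ) * X 2 ^ r) ^ numExc τ := by
  rw [fpoly, Fintype.sum_prod_type_right, sum_filter]
  refine sum_congr rfl fun τ _ => ?_
  split_ifs with hτ
  · rw [← sum_colorings_eq heven hτ, sum_filter]
    refine sum_congr rfl fun z _ => ?_
    by_cases hz : ∀ i, z i + z (τ i) = 0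
    · rw [if_pos ⟨(isCPInvolution_iff z τ).2 ⟨hτ, hz⟩, hpr.trans (half_dvd_csum heven hτ hz)⟩,
        if_pos hz, monomial_eq_prod_localWeight hτ hz]
    · rw [if_neg fun h => hz ((isCPInvolution_iff z τ).1 h.1).2, if_neg hz]
  · exact sum_eq_zero fun z _ => if_neg fun h => hτ ((isCPInvolution_iff z τ).1 h.1).1

theorem fpoly_eq_sum_range {r p : ℕ} [NeZero r] (n : ℕ) (heven : Even r) (hpr : p ∣ r / 2) :
    fpoly r p n = ∑ k ∈ range (n + 1), (numTranspositionProducts n k : MvPolynomial (Fin 3) ℤ) *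
      ((X 0 * (1 + X 2 ^ (r / 2))) ^ (n - 2 * k) *
        (X 1 + ((r - 1 : ℕ) : MvPolynomial (Fin 3) ℤ) * X 2 ^ r) ^ k) := by
  rw [fpoly_eq_sum_involutive n heven hpr, sum_involutive_eq_sum_range]

/-- For even `r ≥ 2` and `p ≥ 1` with `p ∣ r/2`:
`f_{r,p,0} = 1`, `f_{r,p,1} = u(1 + w^{r/2})`, and for `n ≥ 2`,
`f_{r,p,n} = u(1 + w^{r/2})·f_{r,p,n−1} + (n−1)(v + (r−1)wʳ)·f_{r,p,n−2}`. -/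
theorem fpoly_recurrence_even_dvd (r p : ℕ) [NeZero r] (hr : 2 ≤ r) (heven : Even r)
    (hp : 1 ≤ p) (hpr : p ∣ r / 2) :
    fpoly r p 0 = 1 ∧
    fpoly r p 1 = X 0 * (1 + X 2 ^ (r / 2)) ∧
    ∀ n : ℕ, 2 ≤ n →
      fpoly r p n =
        X 0 * (1 + X 2 ^ (r / 2)) * fpoly r p (n - 1) +
          ((n - 1 : ℕ) : MvPolynomial (Fin 3) ℤ) *
            (X 1 + ((r - 1 : ℕ) : MvPolynomial (Fin 3) ℤ) * X 2 ^ r) * fpoly r p (n - 2) := by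
  refine ⟨?_, ?_, fun n hn => ?_⟩
  · rw [fpoly_eq_sum_range 0 heven hpr]
    simp [numTranspositionProducts]
  · rw [fpoly_eq_sum_range 1 heven hpr]
    simp [numTranspositionProducts, sum_range_succ]
  · obtain ⟨m, rfl⟩ := Nat.exists_eq_add_of_le' hn
    rw [show m + 2 - 1 = m + 1 by omega, Nat.add_sub_cancel, fpoly_eq_sum_range (m + 2) heven hpr,
      fpoly_eq_sum_range (m + 1) heven hpr, fpoly_eq_sum_range m heven hpr,
      sum_numTranspositionProducts_succ_succ, Nat.cast_add_one]
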